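/- Under the standing hypotheses in the context (no integrals are needed), one has T₁((a ⊗ 1)·F₁·(1 ⊗ b)) = Δ(a)·(1 ⊗ b) for all a, b ∈ A, where F₁ = (id ⊗ S_C)(E) viewed in A ⊗ A. -/

import Mathlib

open TensorProduct

/-- Slice map `id ⊗ ω` landing in the left tensor factor. -/
noncomputable def sL {B C : Type} [AddCommGroup B] [Module ℂ B] [AddCommGroup C] [Module ℂ C]
    (ω : C →ₗ[ℂ] ℂ) : (B ⊗[ℂ] C) →ₗ[ℂ] B :=
  (TensorProduct.rid ℂ B).toLinearMap ∘ₗ LinearMap.lTensor B ω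

/-- Slice map `ω ⊗ id` landing in the right tensor factor. -/
noncomputable def sR {B C : Type} [AddCommGroup B] [Module ℂ B] [AddCommGroup C] [Module ℂ C]
    (ω : B →ₗ[ℂ] ℂ) : (B ⊗[ℂ] C) →ₗ[ℂ] C :=
  (TensorProduct.lid ℂ C).toLinearMap ∘ₗ LinearMap.rTensor C ω

/-- `u ⊗ v ↦ u ⊗ (v ⊗ 1)`, placing `A ⊗ A` in legs 1 and 2 of the triple tensor product. -/
noncomputable def leg12 (A : Type) [Ring A] [Algebra ℂ A] :
    (A ⊗[ℂ] A) →ₗ[ℂ] A ⊗[ℂ] (A ⊗[ℂ] A) :=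
  TensorProduct.map LinearMap.id ((TensorProduct.mk ℂ A A).flip 1)

/-- `u ⊗ v ↦ u ⊗ (1 ⊗ v)`, placing `A ⊗ A` in legs 1 and 3 of the triple tensor product. -/
noncomputable def leg13 (A : Type) [Ring A] [Algebra ℂ A] :
    (A ⊗[ℂ] A) →ₗ[ℂ] A ⊗[ℂ] (A ⊗[ℂ] A) :=
  TensorProduct.map LinearMap.id (TensorProduct.mk ℂ A A 1)

/-- `F₁ = (id ⊗ S_C)(E)` viewed in `A ⊗ A`. -/
noncomputable def F1A (A : Type) [Ring A] [Algebra ℂ A] (B C : Subalgebra ℂ A)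
    (E' : ↥B ⊗[ℂ] ↥C) (SC : ↥C ≃ₗ[ℂ] ↥B) : A ⊗[ℂ] A :=
  TensorProduct.map B.val.toLinearMap (B.val.toLinearMap ∘ₗ SC.toLinearMap) E'

/-- `F₂ = (S_B ⊗ id)(E)` viewed in `A ⊗ A`. -/
noncomputable def F2A (A : Type) [Ring A] [Algebra ℂ A] (B C : Subalgebra ℂ A)
    (E' : ↥B ⊗[ℂ] ↥C) (SB : ↥B ≃ₗ[ℂ] ↥C) : A ⊗[ℂ] A :=
  TensorProduct.map (C.val.toLinearMap ∘ₗ SB.toLinearMap) C.val.toLinearMap E'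

/-- `F₃ = (id ⊗ S_B⁻¹)(E)` viewed in `A ⊗ A`. -/
noncomputable def F3A (A : Type) [Ring A] [Algebra ℂ A] (B C : Subalgebra ℂ A)
    (E' : ↥B ⊗[ℂ] ↥C) (SB : ↥B ≃ₗ[ℂ] ↥C) : A ⊗[ℂ] A :=
  TensorProduct.map B.val.toLinearMap (B.val.toLinearMap ∘ₗ SB.symm.toLinearMap) E'

/-- `F₄ = (S_C⁻¹ ⊗ id)(E)` viewed in `A ⊗ A`. -/
noncomputable def F4A (A : Type) [Ring A] [Algebra ℂ A] (B C : Subalgebra ℂ A)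
    (E' : ↥B ⊗[ℂ] ↥C) (SC : ↥C ≃ₗ[ℂ] ↥B) : A ⊗[ℂ] A :=
  TensorProduct.map (C.val.toLinearMap ∘ₗ SC.symm.toLinearMap) C.val.toLinearMap E'

/-- `T₁ (a ⊗ b) = Δ(a) · (1 ⊗ b)`. -/
noncomputable def Tmap1 (A : Type) [Ring A] [Algebra ℂ A] (Δ : A →ₗ[ℂ] A ⊗[ℂ] A) :
    (A ⊗[ℂ] A) →ₗ[ℂ] A ⊗[ℂ] A :=
  LinearMap.mul' ℂ (A ⊗[ℂ] A) ∘ₗ TensorProduct.map Δ (TensorProduct.mk ℂ A A 1)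

/-- `T₂ (c ⊗ a) = (c ⊗ 1) · Δ(a)`. -/
noncomputable def Tmap2 (A : Type) [Ring A] [Algebra ℂ A] (Δ : A →ₗ[ℂ] A ⊗[ℂ] A) :
    (A ⊗[ℂ] A) →ₗ[ℂ] A ⊗[ℂ] A :=
  LinearMap.mul' ℂ (A ⊗[ℂ] A) ∘ₗ TensorProduct.map ((TensorProduct.mk ℂ A A).flip 1) Δ

/-- `T₃ (a ⊗ b) = (1 ⊗ b) · Δ(a)`. -/
noncomputable def Tmap3 (A : Type) [Ring A] [Algebra ℂ A] (Δ : A →ₗ[ℂ] A ⊗[ℂ] A) :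
    (A ⊗[ℂ] A) →ₗ[ℂ] A ⊗[ℂ] A :=
  (LinearMap.mul' ℂ (A ⊗[ℂ] A) ∘ₗ TensorProduct.map (TensorProduct.mk ℂ A A 1) Δ) ∘ₗ
    (TensorProduct.comm ℂ A A).toLinearMap

/-- `T₄ (c ⊗ a) = Δ(a) · (c ⊗ 1)`. -/
noncomputable def Tmap4 (A : Type) [Ring A] [Algebra ℂ A] (Δ : A →ₗ[ℂ] A ⊗[ℂ] A) :
    (A ⊗[ℂ] A) →ₗ[ℂ] A ⊗[ℂ] A :=
  (LinearMap.mul' ℂ (A ⊗[ℂ] A) ∘ₗ TensorProduct.map Δ ((TensorProduct.mk ℂ A A).flip 1)) ∘ₗ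
    (TensorProduct.comm ℂ A A).toLinearMap

lemma sL_tmul {B C : Type} [AddCommGroup B] [Module ℂ B] [AddCommGroup C] [Module ℂ C]
    (ω : C →ₗ[ℂ] ℂ) (b : B) (c : C) : sL ω (b ⊗ₜ[ℂ] c) = ω c • b := by
  simp [sL]

lemma sL_map {B C A : Type} [AddCommGroup B] [Module ℂ B] [AddCommGroup C] [Module ℂ C]
    [AddCommGroup A] [Module ℂ A] (f : B →ₗ[ℂ] A) (g : C →ₗ[ℂ] A) (ω : A →ₗ[ℂ] ℂ)
    (x : B ⊗[ℂ] C) : sL ω (TensorProduct.map f g x) = f (sL (ω ∘ₗ g) x) := by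
  induction x with
  | zero => simp
  | tmul b c => simp [sL_tmul]
  | add x y hx hy => simp [hx, hy]

lemma sL_tmul_one_mul {A : Type} [Ring A] [Algebra ℂ A] (ω : A →ₗ[ℂ] ℂ) (a : A)
    (x : A ⊗[ℂ] A) : sL ω ((a ⊗ₜ[ℂ] (1 : A)) * x) = a * sL ω x := by
  induction x with
  | zero => simp
  | tmul b c => simp [sL_tmul]
  | add x y hx hy => simp [mul_add, hx, hy]

lemma lTensor_sL_assoc_rTensor {A : Type} [Ring A] [Algebra ℂ A] (Δ : A →ₗ[ℂ] A ⊗[ℂ] A)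
    (ω : A →ₗ[ℂ] ℂ) (x : A ⊗[ℂ] A) :
    LinearMap.lTensor A (sL ω) (TensorProduct.assoc ℂ A A A (LinearMap.rTensor A Δ x)) =
      Δ (sL ω x) := by
  have key (t : A ⊗[ℂ] A) (v : A) :
      LinearMap.lTensor A (sL ω) (TensorProduct.assoc ℂ A A A (t ⊗ₜ[ℂ] v)) = ω v • t := by
    induction t with
    | zero => simp
    | tmul b c => simp [sL_tmul]
    | add x y hx hy => simp [add_tmul, hx, hy]
  induction x with
  | zero => simp
  | tmul b c => simp [sL_tmul, key]
  | add x y hx hy => simp only [map_add, hx, hy]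

lemma lTensor_sL_leg12_mul {A : Type} [Ring A] [Algebra ℂ A] (ω : A →ₗ[ℂ] ℂ)
    (p q : A ⊗[ℂ] A) :
    LinearMap.lTensor A (sL ω) (leg12 A p * ((1 : A) ⊗ₜ[ℂ] q)) =
      p * ((1 : A) ⊗ₜ[ℂ] sL ω q) := by
  induction p with
  | zero => simp
  | add x y hx hy => simp only [map_add, add_mul, hx, hy]
  | tmul a b =>
    induction q with
    | zero => simp
    | add x y hx hy => simp only [map_add, tmul_add, mul_add, hx, hy]
    | tmul c d => simp [leg12, sL_tmul]

/-- The antipodal relation contracts the product `x * E` to its left leg. -/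
lemma map_val_mul_eq {A : Type} [Ring A] [Algebra ℂ A] {B C : Subalgebra ℂ A}
    {E : A ⊗[ℂ] A} {SC : ↥C →ₗ[ℂ] ↥B}
    (h : ∀ c : ↥C, ((1 : A) ⊗ₜ[ℂ] (c : A)) * E = ((SC c : A) ⊗ₜ[ℂ] (1 : A)) * E)
    (x : ↥B ⊗[ℂ] ↥C) :
    TensorProduct.map B.val.toLinearMap C.val.toLinearMap x * E =
      (LinearMap.mul' ℂ A
        (TensorProduct.map B.val.toLinearMap (B.val.toLinearMap ∘ₗ SC) x) ⊗ₜ[ℂ] (1 : A)) * E := by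
  induction x with
  | zero => simp
  | add x y hx hy => simp only [map_add, add_mul, add_tmul, hx, hy]
  | tmul b c =>
    have h' := congrArg (((b : A) ⊗ₜ[ℂ] (1 : A)) * ·) (h c)
    simpa [← mul_assoc] using h'

/-- If `Δ` acts on the left legs of `x` as `y ↦ E * (1 ⊗ y)`, then `T₁` multiplies these legs
into the second factor. -/
lemma Tmap1_mul_map {A : Type} [Ring A] [Algebra ℂ A] {Δ : A →ₗ[ℂ] A ⊗[ℂ] A}
    (hΔmul : ∀ a a' : A, Δ (a * a') = Δ a * Δ a') {E : A ⊗[ℂ] A} {B : Subalgebra ℂ A}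
    (hB : ∀ y : ↥B, Δ y = E * ((1 : A) ⊗ₜ[ℂ] (y : A)))
    {M : Type} [AddCommGroup M] [Module ℂ M] (g : M →ₗ[ℂ] A) (a b : A) (x : ↥B ⊗[ℂ] M) :
    Tmap1 A Δ ((a ⊗ₜ[ℂ] (1 : A)) * TensorProduct.map B.val.toLinearMap g x *
        ((1 : A) ⊗ₜ[ℂ] b)) =
      Δ a * E * ((1 : A) ⊗ₜ[ℂ] (LinearMap.mul' ℂ A
        (TensorProduct.map B.val.toLinearMap g x))) * ((1 : A) ⊗ₜ[ℂ] b) := by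
  induction x with
  | zero => simp
  | add x y hx hy => simp only [map_add, mul_add, add_mul, tmul_add, hx, hy]
  | tmul y c => simp [Tmap1, hΔmul, hB, mul_assoc]

theorem statement14
    (A : Type) [Ring A] [Algebra ℂ A]
    (Δ : A →ₗ[ℂ] A ⊗[ℂ] A)
    (hΔmul : ∀ a a' : A, Δ (a * a') = Δ a * Δ a')
    (hΔcoassoc : ∀ a : A,
      TensorProduct.assoc ℂ A A A (LinearMap.rTensor A Δ (Δ a)) = LinearMap.lTensor A Δ (Δ a))
    (hΔfullL : Submodule.span ℂ {x : A | ∃ ω : A →ₗ[ℂ] ℂ, ∃ a : A, x = sL ω (Δ a)} = ⊤)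
    (hΔfullR : Submodule.span ℂ {x : A | ∃ ω : A →ₗ[ℂ] ℂ, ∃ a : A, x = sR ω (Δ a)} = ⊤)
    (E : A ⊗[ℂ] A)
    (hEE : E * E = E)
    (hEΔ : ∀ a : A, E * Δ a = Δ a ∧ Δ a * E = Δ a)
    (hranL : (Submodule.span ℂ {y : A ⊗[ℂ] A | ∃ a z, y = Δ a * z} : Set (A ⊗[ℂ] A)) =
      {y : A ⊗[ℂ] A | ∃ z, y = E * z})
    (hranR : (Submodule.span ℂ {y : A ⊗[ℂ] A | ∃ a z, y = z * Δ a} : Set (A ⊗[ℂ] A)) =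
      {y : A ⊗[ℂ] A | ∃ z, y = z * E})
    (hΔE1 : TensorProduct.assoc ℂ A A A (LinearMap.rTensor A Δ E) =
      leg12 A E * ((1 : A) ⊗ₜ[ℂ] E))
    (hΔE2 : leg12 A E * ((1 : A) ⊗ₜ[ℂ] E) = ((1 : A) ⊗ₜ[ℂ] E) * leg12 A E)
    (B C : Subalgebra ℂ A)
    (E' : ↥B ⊗[ℂ] ↥C)
    (hE'E : TensorProduct.map B.val.toLinearMap C.val.toLinearMap E' = E)
    (hE'full1 : Submodule.span ℂ {x : ↥B | ∃ ω : ↥C →ₗ[ℂ] ℂ, x = sL ω E'} = ⊤)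
    (hE'full2 : Submodule.span ℂ {y : ↥C | ∃ ω : ↥B →ₗ[ℂ] ℂ, y = sR ω E'} = ⊤)
    (SB : ↥B ≃ₗ[ℂ] ↥C) (SC : ↥C ≃ₗ[ℂ] ↥B)
    (hSBanti : ∀ b b' : ↥B, SB (b * b') = SB b' * SB b)
    (hSCanti : ∀ c c' : ↥C, SC (c * c') = SC c' * SC c)
    (hSBrel : ∀ b : ↥B, E' * (b ⊗ₜ[ℂ] (1 : ↥C)) = E' * ((1 : ↥B) ⊗ₜ[ℂ] SB b))
    (hSCrel : ∀ c : ↥C, ((1 : ↥B) ⊗ₜ[ℂ] c) * E' = (SC c ⊗ₜ[ℂ] (1 : ↥C)) * E')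
 :
    ∀ a b : A,
      Tmap1 A Δ ((a ⊗ₜ[ℂ] (1 : A)) * F1A A B C E' SC * ((1 : A) ⊗ₜ[ℂ] b)) =
        Δ a * ((1 : A) ⊗ₜ[ℂ] b) := by
  intro a b
  have hE (ω : ↥C →ₗ[ℂ] ℂ) : ∃ ω' : A →ₗ[ℂ] ℂ, sL ω' E = (sL ω E' : ↥B) := by
    obtain ⟨ω', rfl⟩ := LinearMap.exists_extend (p := Subalgebra.toSubmodule C) ω
    exact ⟨ω', hE'E ▸ sL_map B.val.toLinearMap C.val.toLinearMap ω' E'⟩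
  have hB (y : ↥B) : Δ y = E * ((1 : A) ⊗ₜ[ℂ] (y : A)) := by
    induction (hE'full1 ▸ Submodule.mem_top : y ∈ Submodule.span ℂ _)
      using Submodule.span_induction with
    | mem y hy =>
      obtain ⟨ω, rfl⟩ := hy
      obtain ⟨ω', h⟩ := hE ω
      rw [← h, ← lTensor_sL_assoc_rTensor, hΔE1, lTensor_sL_leg12_mul]
    | zero => simp
    | add x y _ _ hx hy => simp [hx, hy, tmul_add, mul_add]
    | smul r x _ hx => simp [hx]
  have hSC (c : ↥C) :
      ((1 : A) ⊗ₜ[ℂ] (c : A)) * E = ((SC.toLinearMap c : A) ⊗ₜ[ℂ] (1 : A)) * E := by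
    have h := congrArg (Algebra.TensorProduct.map B.val C.val) (hSCrel c)
    have hE'' : Algebra.TensorProduct.map B.val C.val E' = E := hE'E
    simpa [hE''] using h
  set m := LinearMap.mul' ℂ A (F1A A B C E' SC)
  have hmE : E = (m ⊗ₜ[ℂ] (1 : A)) * E := by
    have h := map_val_mul_eq hSC E'
    rwa [hE'E, hEE] at h
  have hmB (y : ↥B) : m * (y : A) = y := by
    induction (hE'full1 ▸ Submodule.mem_top : y ∈ Submodule.span ℂ _)
      using Submodule.span_induction with
    | mem y hy =>
      obtain ⟨ω, rfl⟩ := hy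
      obtain ⟨ω', h⟩ := hE ω
      rw [← h, ← sL_tmul_one_mul, ← hmE]
    | zero => simp
    | add x y _ _ hx hy => simp [hx, hy, mul_add]
    | smul r x _ hx => simp [hx]
  have hm1 : m = 1 := by simpa using hmB 1
  have h := Tmap1_mul_map hΔmul hB (B.val.toLinearMap ∘ₗ SC.toLinearMap) a b E'
  change _ = Δ a * E * ((1 : A) ⊗ₜ[ℂ] m) * ((1 : A) ⊗ₜ[ℂ] b) at h
  rw [hm1, (hEΔ a).2, ← Algebra.TensorProduct.one_def, mul_one] at h
  exact h
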